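/- Let ⟨{a,b}, C, d, O, v, (≺_a, ≺_b)⟩ be a two-player antagonistic infinite sequential game, i.e. ≺_b = ≺^{-1} where ≺ := ≺_a, and let Γ be a collection of subsets of C^ω. Assume: (1) ≺ is a strict weak order; (2) for each X ∈ {a,b}, for every play p ∈ C^ω and strictly increasing φ : ℕ → ℕ, if d(p_{<φ(n)}) = X and G_X(p_{<φ(n+1)}) ⊊ G_X(p_{<φ(n)}) for all n ∈ ℕ, then v(p) ∈ ∩_{n∈ℕ} G_X(p_{<φ(n)}); (3) for each X ∈ {a,b} and every γ ∈ C* there is a strategy s of X with g_X(γ,s) = G_X(γ); (4) for every nonempty closed set E ⊆ C^ω (product topology, C discrete) there exist o, o' ∈ v[E] such that ¬(o ≺ x) and ¬(x ≺ o') for all x ∈ v[E]; (5) for every ≺-extremal interval I and every γ ∈ C*, v^{-1}(I) ∩ γC^ω ∈ Γ; (6) every two-player win/lose game ⟨C, D, W⟩ with D ⊆ C* and W ∈ Γ is determined. Then the game has a subgame perfect equilibrium. -/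

import Mathlib

namespace SeqGame

variable {A C O : Type*}

/-- The length-`n` prefix of an infinite sequence, as a list. -/
def pre (p : ℕ → C) (n : ℕ) : List C := List.ofFn (fun i : Fin n => p i)

/-- The length-`n` history of the play induced by the strategy profile `σ` starting at `γ`. -/
def hist (σ : List C → C) (γ : List C) : ℕ → List C
  | 0 => []
  | n + 1 => hist σ γ n ++
      [if h : n < γ.length then γ.get ⟨n, h⟩ else σ (hist σ γ n)]

/-- The play `p^γ(σ)` induced by the strategy profile `σ` starting at `γ`. -/
def play (σ : List C → C) (γ : List C) (n : ℕ) : C :=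
  if h : n < γ.length then γ.get ⟨n, h⟩ else σ (hist σ γ n)

/-- `σ'` is an `a`-deviation of the strategy profile `σ`. -/
def Dev (d : List C → A) (a : A) (σ σ' : List C → C) : Prop :=
  ∀ h : List C, d h ≠ a → σ' h = σ h

/-- `r` is a strict weak order: irreflexive, transitive, with transitive incomparability. -/
def SWO (r : O → O → Prop) : Prop :=
  (∀ x, ¬ r x x) ∧ (∀ x y z, r x y → r y z → r x z) ∧
  (∀ x y z, ¬ r x y → ¬ r y z → ¬ r x z)

/-- `r` is a strict linear order: irreflexive, transitive and total. -/
def SLO (r : O → O → Prop) : Prop :=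
  (∀ x, ¬ r x x) ∧ (∀ x y z, r x y → r y z → r x z) ∧
  (∀ x y, x = y ∨ r x y ∨ r y x)

/-- The play `p` is consistent with the strategy `s` of player `a` from `γ` on. -/
def Consistent (d : List C → A) (a : A) (s : List C → C) (γ : List C) (p : ℕ → C) : Prop :=
  pre p γ.length = γ ∧ ∀ n, γ.length ≤ n → d (pre p n) = a → p n = s (pre p n)

/-- The guarantee `g_a(γ, s)` of player `a` (with preference `r`) by strategy `s` at `γ`. -/
def gua (d : List C → A) (v : (ℕ → C) → O) (r : O → O → Prop) (a : A)
    (γ : List C) (s : List C → C) : Set O :=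
  {o | ∃ p : ℕ → C, Consistent d a s γ p ∧ ¬ r o (v p)}

/-- The best guarantee `G_a(γ)` of player `a` (with preference `r`) at `γ`. -/
def Gua (d : List C → A) (v : (ℕ → C) → O) (r : O → O → Prop) (a : A) (γ : List C) : Set O :=
  ⋂ s : List C → C, gua d v r a γ s

/-- `I` is a `r`-terminal interval: `o ∈ I` and `¬(o' ≺ o)` imply `o' ∈ I`. -/
def Terminal (r : O → O → Prop) (I : Set O) : Prop :=
  ∀ o ∈ I, ∀ o', ¬ r o' o → o' ∈ I

/-- `I` is a `r`-extremal interval. -/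
def Extremal (r : O → O → Prop) (I : Set O) : Prop :=
  Terminal r I ∨ Terminal (fun x y => r y x) I

/-- `γ C^ω`: the set of plays extending the finite sequence `γ`. -/
def ext (γ : List C) : Set (ℕ → C) := {p | pre p γ.length = γ}

/-- Concatenation `γ·α` of a finite sequence and an infinite one. -/
def cat (γ : List C) (α : ℕ → C) : ℕ → C :=
  fun n => if h : n < γ.length then γ.get ⟨n, h⟩ else α (n - γ.length)

/-- The two-player win/lose game `⟨C, D, W⟩` is determined. -/
def Determined (D : Set (List C)) (W : Set (ℕ → C)) : Prop :=
  (∃ s : List C → C, ∀ p : ℕ → C, (∀ n, pre p n ∈ D → p n = s (pre p n)) → p ∈ W) ∨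
  (∃ t : List C → C, ∀ p : ℕ → C, (∀ n, pre p n ∉ D → p n = t (pre p n)) → p ∉ W)

/-- In a two-player game (`true` is player `a`, `false` is player `b`) with antagonistic
preferences, the preference of each player derived from the preference `r` of player `a`. -/
def rel (r : O → O → Prop) : Bool → O → O → Prop
  | true => r
  | false => fun o o' => r o' o

end SeqGame

namespace SeqGame

@[simp] lemma length_pre {C : Type*} (p : ℕ → C) (n : ℕ) : (pre p n).length = n := by
  simp [pre]

lemma pre_succ {C : Type*} (p : ℕ → C) (n : ℕ) : pre p (n + 1) = pre p n ++ [p n] := by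
  simp only [pre, List.ofFn_succ_last, Fin.val_castSucc, Fin.val_last]

lemma pre_eq_iff {C : Type*} (p q : ℕ → C) (n : ℕ) :
    pre p n = pre q n ↔ ∀ k < n, p k = q k := by
  simp only [pre, List.ofFn_inj, funext_iff]
  exact ⟨fun h k hk => h ⟨k, hk⟩, fun h k => h k k.2⟩

lemma pre_congr {C : Type*} {p q : ℕ → C} {m n : ℕ} (h : pre p n = pre q n) (hm : m ≤ n) :
    pre p m = pre q m :=
  (pre_eq_iff p q m).2 fun k hk => (pre_eq_iff p q n).1 h k (hk.trans_le hm)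

lemma hist_eq_pre_play {C : Type*} (σ : List C → C) (γ : List C) (n : ℕ) :
    hist σ γ n = pre (play σ γ) n := by
  induction n with
  | zero => simp [hist, pre]
  | succ n ih => rw [pre_succ, ← ih]; rfl

lemma pre_play {C : Type*} (σ : List C → C) (γ : List C) : pre (play σ γ) γ.length = γ := by
  apply List.ext_get (by simp)
  intro n h₁ h₂
  simp_all [pre, play]

lemma play_of_length_le {C : Type*} (σ : List C → C) (γ : List C) {n : ℕ} (h : γ.length ≤ n) :
    play σ γ n = σ (pre (play σ γ) n) := by
  rw [← hist_eq_pre_play, play, dif_neg h.not_gt]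

/-- A play induced by a profile that agrees with `s` at the positions of player `a` is consistent
with `s`. -/
lemma consistent_play {A C : Type*} {d : List C → A} {a : A} {s σ : List C → C}
    (h : ∀ k, d k = a → σ k = s k) (γ : List C) : Consistent d a s γ (play σ γ) :=
  ⟨pre_play σ γ, fun _ hn hd => by rw [play_of_length_le σ γ hn, h _ hd]⟩

/-- Along a play segment that follows `s`, the guarantee of `s` shrinks. -/
lemma gua_pre_subset {A C O : Type*} {d : List C → A} {v : (ℕ → C) → O} {r : O → O → Prop} {a : A}
    {s : List C → C} {p : ℕ → C} {i j : ℕ} (hij : i ≤ j)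
    (hp : ∀ k, i ≤ k → k < j → d (pre p k) = a → p k = s (pre p k)) :
    gua d v r a (pre p j) s ⊆ gua d v r a (pre p i) s := by
  rintro o ⟨q, ⟨hq, hqs⟩, ho⟩
  simp only [length_pre] at hq hqs
  refine ⟨q, ⟨by simpa using pre_congr hq hij, fun n hn hd => ?_⟩, ho⟩
  rw [length_pre] at hn
  rcases lt_or_ge n j with hnj | hnj
  · rw [(pre_eq_iff q p j).1 hq n hnj, pre_congr hq hnj.le]
    exact hp n hn hnj (pre_congr hq hnj.le ▸ hd)
  · exact hqs n hnj hd

open Classical in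
/-- The strategy in force after a history (given in reverse order), when the owner `a` keeps the
current strategy as long as it realises the best guarantee and otherwise switches to `opt`. -/
noncomputable def currentStrategy {A C O : Type*} (d : List C → A) (v : (ℕ → C) → O)
    (r : O → O → Prop) (a : A) (opt : List C → List C → C) : List C → List C → C
  | [] => opt []
  | c :: l =>
    if d (c :: l).reverse = a ∧
        gua d v r a (c :: l).reverse (currentStrategy d v r a opt l) ≠ Gua d v r a (c :: l).reverse
    then opt (c :: l).reverse
    else currentStrategy d v r a opt l

/-- If best guarantees are realised at every position, and are respected by plays along which they
improve infinitely often, then a single strategy realises all best guarantees. -/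
lemma exists_subgame_optimal {A C O : Type*} (d : List C → A) (v : (ℕ → C) → O)
    (r : O → O → Prop) (a : A)
    (hlim : ∀ (p : ℕ → C) (φ : ℕ → ℕ), StrictMono φ → (∀ n, d (pre p (φ n)) = a) →
      (∀ n, Gua d v r a (pre p (φ (n + 1))) ⊂ Gua d v r a (pre p (φ n))) →
      v p ∈ ⋂ n, Gua d v r a (pre p (φ n)))
    (hopt : ∀ γ : List C, ∃ s : List C → C, gua d v r a γ s = Gua d v r a γ)
    (hirr : ∀ x, ¬ r x x) :
    ∃ s : List C → C, ∀ (γ : List C) (p : ℕ → C), Consistent d a s γ p → v p ∈ Gua d v r a γ := by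
  classical
  choose opt hopt using hopt
  refine ⟨fun h => currentStrategy d v r a opt h.reverse h, fun γ p hp => ?_⟩
  obtain ⟨hγ, hps⟩ := hp
  set N := γ.length
  set S : ℕ → List C → C := fun n => currentStrategy d v r a opt (pre p n).reverse with hS
  have hps' : ∀ n, N ≤ n → d (pre p n) = a → p n = S n (pre p n) := hps
  have hstep : ∀ n, S (n + 1) = if d (pre p (n + 1)) = a ∧
      gua d v r a (pre p (n + 1)) (S n) ≠ Gua d v r a (pre p (n + 1))
      then opt (pre p (n + 1)) else S n := by
    intro n
    have : (pre p (n + 1)).reverse = p n :: (pre p n).reverse := by simp [pre_succ]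
    have h' : (p n :: (pre p n).reverse).reverse = pre p (n + 1) := by rw [← this]; simp
    simp only [hS, this]
    rw [currentStrategy, h']
  have hSopt : ∀ n, d (pre p n) = a → gua d v r a (pre p n) (S n) = Gua d v r a (pre p n) := by
    intro n hd
    cases n with
    | zero => exact hopt []
    | succ n =>
      rw [hstep]
      split_ifs with h
      · exact hopt _
      · by_contra h'
        exact h ⟨hd, h'⟩
  have hGua_sub : ∀ γ s, Gua d v r a γ ⊆ gua d v r a γ s := fun γ s => Set.iInter_subset _ s
  have hmono_step : ∀ n, N ≤ n → Gua d v r a (pre p (n + 1)) ⊆ Gua d v r a (pre p n) := by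
    intro n hn
    by_cases hd : d (pre p n) = a
    · rw [← hSopt n hd]
      refine (hGua_sub _ (S n)).trans (gua_pre_subset n.le_succ fun k h₁ h₂ hk => ?_)
      obtain rfl : k = n := by omega
      exact hps' k hn hk
    · rw [← hopt (pre p n)]
      refine (hGua_sub _ (opt (pre p n))).trans (gua_pre_subset n.le_succ fun k h₁ h₂ hk => ?_)
      obtain rfl : k = n := by omega
      exact absurd hk hd
  have hmono : ∀ n, N ≤ n → Gua d v r a (pre p n) ⊆ Gua d v r a γ := by
    intro n hn
    induction n, hn using Nat.le_induction with
    | base => rw [hγ]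
    | succ n hn ih => exact (hmono_step n hn).trans ih
  by_cases hfin : ∃ M, N ≤ M ∧ ∀ j, M ≤ j → S (j + 1) = S j
  · obtain ⟨M, hNM, hM⟩ := hfin
    have hconst : ∀ j, M ≤ j → S j = S M := by
      intro j hj
      induction j, hj using Nat.le_induction with
      | base => rfl
      | succ j hj ih => rw [hM j hj, ih]
    by_cases hX : ∃ n, M ≤ n ∧ d (pre p n) = a
    · obtain ⟨n, hn, hd⟩ := hX
      refine hmono n (hNM.trans hn) ?_
      rw [← hSopt n hd]
      refine ⟨p, ⟨by simp, fun k hk hdk => ?_⟩, hirr _⟩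
      rw [length_pre] at hk
      rw [hps' k (by omega) hdk, hconst k (by omega), hconst n hn]
    · refine hmono M hNM (Set.mem_iInter.2 fun s => ⟨p, ⟨by simp, fun k hk hdk => ?_⟩, hirr _⟩)
      rw [length_pre] at hk
      exact absurd ⟨k, hk, hdk⟩ hX
  · push Not at hfin
    have hswitch : ∀ j, S (j + 1) ≠ S j → d (pre p (j + 1)) = a ∧
        gua d v r a (pre p (j + 1)) (S j) ≠ Gua d v r a (pre p (j + 1)) := by
      intro j hj
      by_contra h
      exact hj (by rw [hstep, if_neg h])
    have hnext : ∀ i : {i // N ≤ i ∧ d (pre p i) = a}, ∃ j : {i // N ≤ i ∧ d (pre p i) = a},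
        i.1 < j.1 ∧ Gua d v r a (pre p j) ⊂ Gua d v r a (pre p i) := by
      rintro ⟨i, hNi, hdi⟩
      have hex := hfin i hNi
      obtain ⟨hij, hj⟩ := Nat.find_spec hex
      have hmin := fun m hm => Nat.find_min hex (m := m) hm
      set j := Nat.find hex
      have hconst : ∀ k, i ≤ k → k ≤ j → S k = S i := by
        intro k hk
        induction k, hk using Nat.le_induction with
        | base => intro _; rfl
        | succ k hk ih =>
          intro hkj
          rw [← ih (by omega)]
          by_contra h
          exact hmin k (by omega) ⟨hk, h⟩
      obtain ⟨hdj, hne⟩ := hswitch j hj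
      refine ⟨⟨j + 1, by omega, hdj⟩, Nat.lt_succ_of_le hij, ?_⟩
      refine ((hGua_sub _ (S j)).ssubset_of_ne (Ne.symm hne)).trans_subset ?_
      rw [← hSopt i hdi, hconst j hij le_rfl]
      refine gua_pre_subset (by omega) fun k h₁ h₂ hk => ?_
      rw [hps' k (by omega) hk, hconst k h₁ (by omega)]
    choose next hlt hss using hnext
    obtain ⟨j, hj, hjne⟩ := hfin N le_rfl
    let φ : ℕ → {i // N ≤ i ∧ d (pre p i) = a} :=
      fun n => next^[n] ⟨j + 1, by omega, (hswitch j hjne).1⟩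
    have hφ : ∀ n, φ (n + 1) = next (φ n) := fun n => Function.iterate_succ_apply' _ _ _
    have := hlim p (fun n => (φ n).1) (strictMono_nat_of_lt_succ fun n => by rw [hφ]; exact hlt _)
      (fun n => (φ n).2.2) (fun n => by simp only [hφ]; exact hss _)
    exact hmono _ (φ 0).2.1 (Set.mem_iInter.1 this 0)

/-- In a determined antagonistic game, an outcome in the best guarantee of the first player is
never worse for that player than an outcome in the best guarantee of the opponent. -/
lemma not_rel_of_mem_Gua {C O : Type*} {d : List C → Bool} {v : (ℕ → C) → O}
    {r : O → O → Prop} (hr : SWO r) {γ : List C}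
    (hdet : ∀ I : Set O, Terminal r I → ∀ D, Determined D (v ⁻¹' I ∩ ext γ)) {x y : O}
    (hx : x ∈ Gua d v r true γ) (hy : y ∈ Gua d v (fun o o' => r o' o) false γ) : ¬ r x y := by
  obtain ⟨-, htrans, hneg⟩ := hr
  intro hxy
  have hI : Terminal r {o | r x o} := fun o ho o' ho' => by
    by_contra h
    exact hneg x o' o h ho' ho
  rcases hdet _ hI {h | d h = true ∨ h.length < γ.length} with ⟨s, hs⟩ | ⟨t, ht⟩
  · obtain ⟨p, ⟨hpγ, hp⟩, hxp⟩ := Set.mem_iInter.1 hx s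
    have hq : pre (play s []) γ.length = γ :=
      (hs (play s []) fun n _ => play_of_length_le s [] (Nat.zero_le n)).2
    have hpq : pre p γ.length = pre (play s []) γ.length := hpγ.trans hq.symm
    refine hxp (hs p fun n hn => ?_).1
    rcases lt_or_ge n γ.length with hlt | hge
    · rw [(pre_eq_iff _ _ _).1 hpq n hlt, pre_congr hpq hlt.le]
      exact play_of_length_le s [] (Nat.zero_le n)
    · exact hp n hge (hn.resolve_right (by simpa using hge))
  · obtain ⟨p, ⟨hpγ, hp⟩, hyp⟩ := Set.mem_iInter.1 hy t
    have hpW := ht p fun n hn => by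
      simp only [Set.mem_ofPred_eq, length_pre, not_or, not_lt, Bool.not_eq_true] at hn
      exact hp n hn.2 hn.1
    exact hneg x (v p) y (fun h => hpW ⟨h, hpγ⟩) hyp hxy

end SeqGame

open SeqGame in
/-- abstract existence of subgame perfect equilibria in two-player
antagonistic infinite sequential games (player `a` is `true`, player `b` is `false`,
with preferences `r` and its inverse). -/
theorem stmt8 {C O : Type*} [Nonempty C] [Nonempty O]
    [TopologicalSpace C] [DiscreteTopology C]
    (d : List C → Bool) (v : (ℕ → C) → O) (r : O → O → Prop)
    (Γ : Set (Set (ℕ → C)))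
    (h1 : SWO r)
    (h2 : ∀ (X : Bool) (p : ℕ → C) (φ : ℕ → ℕ), StrictMono φ →
      (∀ n, d (pre p (φ n)) = X) →
      (∀ n, Gua d v (rel r X) X (pre p (φ (n + 1))) ⊂ Gua d v (rel r X) X (pre p (φ n))) →
      v p ∈ ⋂ n, Gua d v (rel r X) X (pre p (φ n)))
    (h3 : ∀ (X : Bool) (γ : List C), ∃ s : List C → C,
      gua d v (rel r X) X γ s = Gua d v (rel r X) X γ)
    (h4 : ∀ E : Set (ℕ → C), IsClosed E → E.Nonempty →
      (∃ o ∈ v '' E, ∀ x ∈ v '' E, ¬ r o x) ∧ (∃ o' ∈ v '' E, ∀ x ∈ v '' E, ¬ r x o'))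
    (h5 : ∀ I : Set O, Extremal r I → ∀ γ : List C, (v ⁻¹' I ∩ ext γ) ∈ Γ)
    (h6 : ∀ (D : Set (List C)) (W : Set (ℕ → C)), W ∈ Γ → Determined D W) :
    ∃ σ : List C → C, ∀ (γ : List C) (X : Bool) (σ' : List C → C), Dev d X σ σ' →
      ¬ rel r X (v (play σ γ)) (v (play σ' γ)) := by
  obtain ⟨s, hs⟩ := exists_subgame_optimal d v r true (h2 true) (h3 true) h1.1
  obtain ⟨t, ht⟩ := exists_subgame_optimal d v (fun o o' => r o' o) false (h2 false) (h3 false) h1.1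
  have hσs : ∀ k, d k = true → (if d k then s k else t k) = s k := fun k hk => by simp [hk]
  have hσt : ∀ k, d k = false → (if d k then s k else t k) = t k := fun k hk => by simp [hk]
  refine ⟨fun h => if d h then s h else t h, fun γ X σ' hdev => ?_⟩
  have hcomp : ∀ {x y}, x ∈ Gua d v r true γ → y ∈ Gua d v (fun o o' => r o' o) false γ → ¬ r x y :=
    not_rel_of_mem_Gua h1 fun I hI D => h6 D _ (h5 I (Or.inl hI) γ)
  cases X with
  | true =>
    refine hcomp (hs γ _ (consistent_play hσs γ)) (ht γ _ (consistent_play (fun k hk => ?_) γ))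
    exact (hdev k (by simp [hk])).trans (hσt k hk)
  | false =>
    refine hcomp (hs γ _ (consistent_play (fun k hk => ?_) γ)) (ht γ _ (consistent_play hσt γ))
    exact (hdev k (by simp [hk])).trans (hσs k hk)
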